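/- arXiv:1805.04293 — 2 statements merged into one kernel-verified Lean document; each statement's English description precedes it below -/
import Mathlib

section
/- The operator T on the Fock space A²(ℂ, e^{-|z|²}) that assigns to each f ∈ A²(ℂ, e^{-|z|²}) its unique primitive h (an entire function with h' = f and h(0) = 0) maps A²(ℂ, e^{-|z|²}) into itself and is a compact linear operator on A²(ℂ, e^{-|z|²}). -/
open MeasureTheory Filter Complex

noncomputable section

/-- The Gaussian weight `e^{-|z|^2}` on `ℂ`. -/
def fockWt (z : ℂ) : ℝ := Real.exp (-‖z‖ ^ 2)

/-- The squared norm of the Fock space `A²(ℂ, e^{-|z|²})`: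
`‖f‖² = ∫_ℂ |f(z)|² e^{-|z|²} dλ(z)`. -/
def fockNormSq (f : ℂ → ℂ) : ℝ := ∫ z : ℂ, ‖f z‖ ^ 2 * fockWt z

/-- The inner product of the Fock space:
`(f,g) = ∫_ℂ f(z) conj (g(z)) e^{-|z|²} dλ(z)`. -/
def fockInner (f g : ℂ → ℂ) : ℂ := ∫ z : ℂ, f z * (starRingEnd ℂ) (g z) * fockWt z

/-- Membership in the Fock space `A²(ℂ, e^{-|z|²})`: `f` is entire and
`∫_ℂ |f|² e^{-|z|²} dλ < ∞`. -/
def MemFock (f : ℂ → ℂ) : Prop :=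
  Differentiable ℂ f ∧ Integrable (fun z : ℂ => ‖f z‖ ^ 2 * fockWt z)

theorem integral_exp_pow_mul_conj_exp_pow (n m : ℕ) :
    ∫ θ in Set.Ioo (-Real.pi) Real.pi,
      exp (θ * I) ^ n * (starRingEnd ℂ) (exp (θ * I) ^ m) =
        if n = m then (2 * Real.pi : ℂ) else 0 := by
  have key : ∀ θ : ℝ, exp (θ * I) ^ n * (starRingEnd ℂ) (exp (θ * I) ^ m) =
      exp (((n : ℂ) - m) * I * θ) := by
    intro θ
    rw [← exp_nat_mul, ← exp_nat_mul, ← exp_conj, ← exp_add]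
    congr 1
    simp only [map_mul, conj_ofReal, conj_I, map_natCast]
    ring
  simp_rw [key]
  rw [← integral_Ioc_eq_integral_Ioo,
    ← intervalIntegral.integral_of_le (by linarith [Real.pi_pos])]
  split_ifs with h
  · subst h
    simp only [sub_self, zero_mul, exp_zero, intervalIntegral.integral_const]
    simp
    ring
  · have hc : ((n : ℂ) - m) * I ≠ 0 :=
      mul_ne_zero (sub_ne_zero.2 (by exact_mod_cast h)) I_ne_zero
    rw [integral_exp_mul_complex hc]
    have : exp (((n : ℂ) - m) * I * (Real.pi : ℝ)) =
        exp (((n : ℂ) - m) * I * ((-Real.pi : ℝ) : ℂ)) := by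
      rw [exp_eq_exp_iff_exists_int]
      exact ⟨(n : ℤ) - m, by push_cast; ring⟩
    rw [this, sub_self, zero_div]

/-- Parseval's identity on the unit circle for absolutely convergent power series. -/
theorem hasSum_sq_norm_circle {b : ℕ → ℂ} (hb : Summable fun n => ‖b n‖) :
    HasSum (fun n => 2 * Real.pi * ‖b n‖ ^ 2)
      (∫ θ in Set.Ioo (-Real.pi) Real.pi, ‖∑' n, b n * exp (θ * I) ^ n‖ ^ 2) := by
  set ν : Measure ℝ := volume.restrict (Set.Ioo (-Real.pi) Real.pi) with hν
  set F : ℝ → ℂ := fun θ => ∑' n, b n * exp (θ * I) ^ n with hF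
  have hnorm : ∀ (n : ℕ) (θ : ℝ), ‖b n * exp (θ * I) ^ n‖ = ‖b n‖ := by
    intro n θ
    simp [norm_exp_ofReal_mul_I]
  have hFc : Continuous F :=
    continuous_tsum (fun n => by fun_prop) hb fun n θ => (hnorm n θ).le
  have hsum : ∀ G : ℝ → ℂ, Continuous G → (∃ C, ∀ θ, ‖G θ‖ ≤ C) →
      HasSum (fun n => ∫ θ, b n * exp (θ * I) ^ n * G θ ∂ν) (∫ θ, F θ * G θ ∂ν) := by
    rintro G hG ⟨C, hC⟩
    have hle : ∀ (n : ℕ) (θ : ℝ), ‖b n * exp (θ * I) ^ n * G θ‖ ≤ ‖b n‖ * C := by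
      intro n θ
      rw [norm_mul, hnorm]
      exact mul_le_mul_of_nonneg_left (hC θ) (norm_nonneg _)
    have hi : ∀ n : ℕ, Integrable (fun θ : ℝ => b n * exp (θ * I) ^ n * G θ) ν := fun n =>
      Integrable.of_bound (by fun_prop) (‖b n‖ * C) (Eventually.of_forall (hle n))
    have h := hasSum_integral_of_summable_integral_norm hi ?_
    · simpa only [tsum_mul_right] using h
    · refine Summable.of_nonneg_of_le (fun n => integral_nonneg fun _ => norm_nonneg _)
        (fun n => ?_) ((hb.mul_right C).mul_right (ν.real Set.univ))
      calc ∫ θ, ‖b n * exp (θ * I) ^ n * G θ‖ ∂ν ≤ ∫ _, ‖b n‖ * C ∂ν :=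
            integral_mono (hi n).norm (integrable_const _) (hle n)
        _ = ‖b n‖ * C * ν.real Set.univ := by simp [mul_comm]
  have hcoef : ∀ m : ℕ, ∫ θ, F θ * (starRingEnd ℂ) (exp (θ * I) ^ m) ∂ν =
      2 * Real.pi * b m := by
    intro m
    have h := hsum (fun θ => (starRingEnd ℂ) (exp (θ * I) ^ m)) (by fun_prop)
      ⟨1, fun θ => by simp [norm_exp_ofReal_mul_I]⟩
    simp_rw [mul_assoc, integral_const_mul, hν, integral_exp_pow_mul_conj_exp_pow] at h
    refine h.unique ?_
    convert hasSum_ite_eq m (2 * Real.pi * b m) using 2 with n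
    split_ifs with hnm
    · rw [hnm]; ring
    · simp
  have hFb : ∀ θ, ‖F θ‖ ≤ ∑' n, ‖b n‖ := fun θ =>
    tsum_of_norm_bounded hb.hasSum fun n => (hnorm n θ).le
  have h := hsum (fun θ => (starRingEnd ℂ) (F θ)) (by fun_prop)
    ⟨∑' n, ‖b n‖, fun θ => by simpa using hFb θ⟩
  have h1 : ∀ n : ℕ, ∫ θ, b n * exp (θ * I) ^ n * (starRingEnd ℂ) (F θ) ∂ν =
      ((2 * Real.pi * ‖b n‖ ^ 2 : ℝ) : ℂ) := by
    intro n
    have h2 : ∀ θ : ℝ, b n * exp (θ * I) ^ n * (starRingEnd ℂ) (F θ) =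
        b n * (starRingEnd ℂ) (F θ * (starRingEnd ℂ) (exp (θ * I) ^ n)) := by
      intro θ
      rw [map_mul, conj_conj]
      ring
    simp_rw [h2]
    rw [integral_const_mul, integral_conj, hcoef]
    push_cast
    rw [← mul_conj']
    simp only [map_mul, conj_ofReal, map_ofNat]
    ring
  simp_rw [h1, mul_conj', ← ofReal_pow] at h
  rw [integral_complex_ofReal] at h
  exact_mod_cast h

theorem lintegral_pow_mul_exp_neg_sq (n : ℕ) :
    ∫⁻ r in Set.Ioi (0 : ℝ), ENNReal.ofReal (r ^ (2 * n + 1) * Real.exp (-r ^ 2)) =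
      ENNReal.ofReal (n.factorial / 2) := by
  have hE : ∀ r : ℝ, r ^ (2 * n + 1) * Real.exp (-r ^ 2) =
      r ^ ((2 * n + 1 : ℕ) : ℝ) * Real.exp (-r ^ (2 : ℝ)) := by
    intro r
    rw [Real.rpow_natCast, Real.rpow_two]
  have hI := integral_rpow_mul_exp_neg_rpow (p := 2) (q := ((2 * n + 1 : ℕ) : ℝ)) two_pos
    (by push_cast; linarith [(Nat.cast_nonneg n : (0 : ℝ) ≤ n)])
  have hG : (((2 * n + 1 : ℕ) : ℝ) + 1) / 2 = n + 1 := by push_cast; ring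
  rw [hG, Real.Gamma_nat_eq_factorial] at hI
  simp_rw [← hE] at hI
  have hint : IntegrableOn (fun r : ℝ => r ^ (2 * n + 1) * Real.exp (-r ^ 2)) (Set.Ioi 0) := by
    by_contra hc
    rw [integral_undef hc] at hI
    have : (0 : ℝ) < n.factorial := by exact_mod_cast n.factorial_pos
    linarith
  rw [← ofReal_integral_eq_lintegral_ofReal hint, hI]
  · congr 1; ring
  · filter_upwards [ae_restrict_mem measurableSet_Ioi] with r hr
    have : (0 : ℝ) < r := hr
    positivity

theorem lintegral_fock_eq_tsum {a : ℕ → ℂ} {f : ℂ → ℂ} (hfc : Continuous f)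
    (hf : ∀ z, HasSum (fun n => a n * z ^ n) (f z)) :
    ∫⁻ z, ENNReal.ofReal (‖f z‖ ^ 2 * fockWt z) =
      ∑' n, ENNReal.ofReal (Real.pi * (n.factorial * ‖a n‖ ^ 2)) := by
  have hcirc : ∀ r : ℝ, 0 < r →
      ∫⁻ θ in Set.Ioo (-Real.pi) Real.pi, ENNReal.ofReal (‖f (r * exp (θ * I))‖ ^ 2) =
        ∑' n, ENNReal.ofReal (2 * Real.pi * ‖a n‖ ^ 2 * r ^ (2 * n)) := by
    intro r hr
    have hb : Summable fun n => ‖a n * (r : ℂ) ^ n‖ := (hf r).summable.norm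
    have hF : ∀ θ : ℝ, ∑' n, a n * (r : ℂ) ^ n * exp (θ * I) ^ n = f (r * exp (θ * I)) := by
      intro θ
      rw [← (hf _).tsum_eq]
      simp_rw [mul_pow, mul_assoc]
    have h := hasSum_sq_norm_circle hb
    simp_rw [hF] at h
    have hint : IntegrableOn (fun θ : ℝ => ‖f (r * exp (θ * I))‖ ^ 2)
        (Set.Ioo (-Real.pi) Real.pi) :=
      ((by fun_prop : Continuous fun θ : ℝ =>
        ‖f (r * exp (θ * I))‖ ^ 2).integrableOn_Icc).mono_set Set.Ioo_subset_Icc_self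
    rw [← ofReal_integral_eq_lintegral_ofReal hint
      (Eventually.of_forall fun θ => by positivity), ← h.tsum_eq,
      ENNReal.ofReal_tsum_of_nonneg (fun n => by positivity) h.summable]
    congr 1
    ext n
    rw [norm_mul, norm_pow, norm_real, Real.norm_of_nonneg hr.le]
    congr 1
    ring
  have hmeas : Measurable fun p : ℝ × ℝ => ENNReal.ofReal (p.1 * Real.exp (-p.1 ^ 2)) *
      ENNReal.ofReal (‖f (p.1 * exp (p.2 * I))‖ ^ 2) :=
    (by fun_prop : Continuous fun p : ℝ × ℝ =>
      p.1 * Real.exp (-p.1 ^ 2)).measurable.ennreal_ofReal.mul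
    (by fun_prop : Continuous fun p : ℝ × ℝ =>
      ‖f (p.1 * exp (p.2 * I))‖ ^ 2).measurable.ennreal_ofReal
  calc ∫⁻ z, ENNReal.ofReal (‖f z‖ ^ 2 * fockWt z)
      = ∫⁻ p in Set.Ioi (0 : ℝ) ×ˢ Set.Ioo (-Real.pi) Real.pi,
          ENNReal.ofReal (p.1 * Real.exp (-p.1 ^ 2)) *
            ENNReal.ofReal (‖f (p.1 * exp (p.2 * I))‖ ^ 2) := by
        rw [← Complex.lintegral_comp_polarCoord_symm, polarCoord_target]
        refine setLIntegral_congr_fun (measurableSet_Ioi.prod measurableSet_Ioo) fun p hp => ?_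
        have hp1 : (0 : ℝ) < p.1 := hp.1
        have hz : Complex.polarCoord.symm p = p.1 * exp (p.2 * I) := by
          rw [Complex.polarCoord_symm_apply, exp_mul_I, ofReal_cos, ofReal_sin]
        have hn : ‖(p.1 : ℂ) * exp (p.2 * I)‖ = p.1 := by
          rw [norm_mul, norm_exp_ofReal_mul_I, mul_one, norm_real, Real.norm_of_nonneg hp1.le]
        simp only [smul_eq_mul, hz, fockWt, hn]
        rw [← ENNReal.ofReal_mul hp1.le, ← ENNReal.ofReal_mul (by positivity)]
        congr 1
        ring
    _ = ∫⁻ r in Set.Ioi (0 : ℝ), ∫⁻ θ in Set.Ioo (-Real.pi) Real.pi,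
          ENNReal.ofReal (r * Real.exp (-r ^ 2)) *
            ENNReal.ofReal (‖f (r * exp (θ * I))‖ ^ 2) := by
        rw [Measure.volume_eq_prod, ← Measure.prod_restrict,
          lintegral_prod _ hmeas.aemeasurable]
    _ = ∫⁻ r in Set.Ioi (0 : ℝ), ∑' n, ENNReal.ofReal (2 * Real.pi * ‖a n‖ ^ 2) *
          ENNReal.ofReal (r ^ (2 * n + 1) * Real.exp (-r ^ 2)) := by
        refine setLIntegral_congr_fun measurableSet_Ioi fun r hr => ?_
        have hr : (0 : ℝ) < r := hr
        rw [lintegral_const_mul' _ _ ENNReal.ofReal_ne_top, hcirc r hr, ← ENNReal.tsum_mul_left]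
        congr 1
        ext n
        rw [← ENNReal.ofReal_mul (by positivity), ← ENNReal.ofReal_mul (by positivity)]
        congr 1
        ring
    _ = ∑' n, ENNReal.ofReal (Real.pi * (n.factorial * ‖a n‖ ^ 2)) := by
        rw [lintegral_tsum fun n => by fun_prop]
        congr 1
        ext n
        rw [lintegral_const_mul' _ _ ENNReal.ofReal_ne_top, lintegral_pow_mul_exp_neg_sq,
          ← ENNReal.ofReal_mul (by positivity)]
        congr 1
        ring

theorem fockWt_nonneg (z : ℂ) : 0 ≤ fockWt z := (Real.exp_pos _).le

theorem continuous_fockWt : Continuous fockWt := by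
  unfold fockWt
  fun_prop

/-- An entire function lies in the Fock space iff its Taylor coefficients are square summable
with weights `n!`. -/
theorem memFock_iff_summable {a : ℕ → ℂ} {f : ℂ → ℂ} (hd : Differentiable ℂ f)
    (hf : ∀ z, HasSum (fun n => a n * z ^ n) (f z)) :
    MemFock f ↔ Summable fun n => (n.factorial : ℝ) * ‖a n‖ ^ 2 := by
  have hc := hd.continuous
  have hm : Continuous fun z => ‖f z‖ ^ 2 * fockWt z := by
    have := continuous_fockWt
    fun_prop
  rw [MemFock, and_iff_right hd, ← lintegral_ofReal_ne_top_iff_integrable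
    hm.aestronglyMeasurable (Eventually.of_forall fun z =>
      mul_nonneg (by positivity) (fockWt_nonneg z)), lintegral_fock_eq_tsum hc hf,
    ← summable_mul_left_iff Real.pi_ne_zero]
  refine ⟨fun h => ?_, fun h => h.tsum_ofReal_ne_top⟩
  refine (ENNReal.summable_toReal h).congr fun n => ?_
  rw [ENNReal.toReal_ofReal (by positivity)]

theorem fockNormSq_eq_tsum {a : ℕ → ℂ} {f : ℂ → ℂ} (hF : MemFock f)
    (hf : ∀ z, HasSum (fun n => a n * z ^ n) (f z)) :
    fockNormSq f = Real.pi * ∑' n, (n.factorial : ℝ) * ‖a n‖ ^ 2 := by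
  have hs := ((memFock_iff_summable hF.1 hf).1 hF).mul_left Real.pi
  rw [fockNormSq, integral_eq_lintegral_of_nonneg_ae (Eventually.of_forall fun z =>
      mul_nonneg (by positivity) (fockWt_nonneg z)) hF.2.1,
    lintegral_fock_eq_tsum hF.1.continuous hf,
    ← ENNReal.ofReal_tsum_of_nonneg (fun n => by positivity) hs,
    ENNReal.toReal_ofReal (tsum_nonneg fun n => by positivity), tsum_mul_left]

/-- The `n`-th Taylor coefficient of `f` at the origin. -/
def taylorCoeff (f : ℂ → ℂ) (n : ℕ) : ℂ := (n.factorial : ℂ)⁻¹ * iteratedDeriv n f 0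

theorem hasSum_taylorCoeff {f : ℂ → ℂ} (hf : Differentiable ℂ f) (z : ℂ) :
    HasSum (fun n => taylorCoeff f n * z ^ n) (f z) := by
  refine (hasSum_taylorSeries_of_entire hf 0 z).congr_fun fun n => ?_
  simp only [taylorCoeff, sub_zero, smul_eq_mul]
  ring

theorem taylorCoeff_succ (h : ℂ → ℂ) (n : ℕ) :
    taylorCoeff h (n + 1) = taylorCoeff (deriv h) n / (n + 1) := by
  rw [taylorCoeff, taylorCoeff, iteratedDeriv_succ', Nat.factorial_succ]
  push_cast
  rw [mul_inv, div_eq_mul_inv]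
  ring

theorem hasSum_taylorCoeff_primitive {h : ℂ → ℂ} (hF : MemFock (deriv h)) :
    HasSum (fun n : ℕ => (n : ℝ) * (n.factorial * ‖taylorCoeff h n‖ ^ 2))
      (fockNormSq (deriv h) / Real.pi) := by
  have hs := (memFock_iff_summable hF.1 (hasSum_taylorCoeff hF.1)).1 hF
  rw [fockNormSq_eq_tsum hF (hasSum_taylorCoeff hF.1),
    mul_div_cancel_left₀ _ Real.pi_ne_zero, ← hasSum_nat_add_iff' 1]
  simp only [Finset.range_one, Finset.sum_singleton, Nat.cast_zero, zero_mul, sub_zero]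
  refine hs.hasSum.congr_fun fun n => ?_
  have h1 : ‖(n : ℂ) + 1‖ = n + 1 := by
    rw [← Nat.cast_add_one, norm_natCast, Nat.cast_add_one]
  rw [taylorCoeff_succ, norm_div, h1, Nat.factorial_succ]
  push_cast
  field_simp

theorem summable_of_summable_nat_mul {u : ℕ → ℝ} (h0 : ∀ n, 0 ≤ u n)
    (hs : Summable fun n : ℕ => (n : ℝ) * u n) : Summable u := by
  rw [← summable_nat_add_iff 1] at hs ⊢
  refine hs.of_nonneg_of_le (fun n => h0 _) fun n => ?_
  push_cast
  nlinarith [h0 (n + 1), mul_nonneg (Nat.cast_nonneg n : (0 : ℝ) ≤ n) (h0 (n + 1))]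

theorem MemFock.primitive {h : ℂ → ℂ} (hd : Differentiable ℂ h) (hF : MemFock (deriv h)) :
    MemFock h :=
  (memFock_iff_summable hd (hasSum_taylorCoeff hd)).2
    (summable_of_summable_nat_mul (fun n => by positivity)
      (hasSum_taylorCoeff_primitive hF).summable)

/-- A uniform bound on `∑ n * u i n` makes the tails of `∑ u i n` uniformly small. -/
theorem tendsto_tsum_zero_of_nat_mul {u : ℕ → ℕ → ℝ} {M : ℝ} (h0 : ∀ i n, 0 ≤ u i n)
    (hs : ∀ i, Summable fun n : ℕ => (n : ℝ) * u i n)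
    (hM : ∀ i, ∑' n : ℕ, (n : ℝ) * u i n ≤ M)
    (hu : ∀ n, Tendsto (fun i => u i n) atTop (nhds 0)) :
    Tendsto (fun i => ∑' n, u i n) atTop (nhds 0) := by
  rw [Metric.tendsto_atTop]
  intro ε hε
  obtain ⟨N, hN⟩ := exists_nat_gt (M / (ε / 2))
  have hN' : M < (ε / 2) * (N + 1) := by
    rw [div_lt_iff₀ (by positivity)] at hN
    nlinarith
  have hfin : Tendsto (fun i => ∑ n ∈ Finset.range (N + 1), u i n) atTop (nhds 0) := by
    simpa using tendsto_finsetSum (Finset.range (N + 1)) fun n _ => hu n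
  obtain ⟨K, hK⟩ := (Metric.tendsto_atTop.1 hfin) (ε / 2) (by positivity)
  refine ⟨K, fun i hi => ?_⟩
  have hsu := summable_of_summable_nat_mul (h0 i) (hs i)
  have hK := hK i hi
  rw [Real.dist_eq, sub_zero, abs_lt] at hK
  rw [Real.dist_eq, sub_zero, abs_of_nonneg (tsum_nonneg (h0 i)),
    ← hsu.sum_add_tsum_nat_add (N + 1)]
  have htail : (N + 1 : ℝ) * ∑' n, u i (n + (N + 1)) ≤ M := by
    rw [← tsum_mul_left]
    refine le_trans ?_ (hM i)
    rw [← (hs i).sum_add_tsum_nat_add (N + 1)]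
    refine le_add_of_nonneg_of_le
      (Finset.sum_nonneg fun n _ => mul_nonneg (Nat.cast_nonneg n) (h0 i n)) ?_
    refine (((summable_nat_add_iff (N + 1)).2 hsu).mul_left _).tsum_le_tsum (fun n => ?_)
      ((summable_nat_add_iff (N + 1)).2 (hs i))
    refine mul_le_mul_of_nonneg_right ?_ (h0 _ _)
    push_cast
    linarith [(Nat.cast_nonneg n : (0 : ℝ) ≤ n)]
  have hlt : ∑' n, u i (n + (N + 1)) < ε / 2 := by
    have : (0 : ℝ) < N + 1 := by positivity
    by_contra! hc
    nlinarith
  linarith [hK.2]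

theorem exists_entire_of_summable {c : ℕ → ℂ}
    (hc : Summable fun n : ℕ => (n.factorial : ℝ) * ‖c n‖ ^ 2) :
    ∃ g : ℂ → ℂ, Differentiable ℂ g ∧ ∀ z, HasSum (fun n => c n * z ^ n) (g z) := by
  have hbound : ∀ R : ℝ, 0 ≤ R → Summable fun n => ‖c n‖ * R ^ n := by
    intro R hR
    refine (hc.add (Real.summable_pow_div_factorial (R ^ 2))).of_nonneg_of_le
      (fun n => by positivity) fun n => ?_
    have hn : (0 : ℝ) < n.factorial := by exact_mod_cast n.factorial_pos
    have key : ‖c n‖ * R ^ n * n.factorial ≤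
        (n.factorial * ‖c n‖ ^ 2 + (R ^ 2) ^ n / n.factorial) * n.factorial := by
      rw [add_mul, div_mul_cancel₀ _ hn.ne', ← pow_mul, mul_comm 2 n, pow_mul]
      nlinarith [sq_nonneg (n.factorial * ‖c n‖ - R ^ n), sq_nonneg (R ^ n),
        sq_nonneg (n.factorial * ‖c n‖)]
    exact le_of_mul_le_mul_right key hn
  refine ⟨fun z => ∑' n, c n * z ^ n, fun z => ?_, fun z => ?_⟩
  · have hd : DifferentiableOn ℂ (fun z => ∑' n, c n * z ^ n) (Metric.ball 0 (‖z‖ + 1)) := by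
      refine differentiableOn_tsum_of_summable_norm (hbound (‖z‖ + 1) (by positivity))
        (fun n => by fun_prop) Metric.isOpen_ball fun n w hw => ?_
      rw [norm_mul, norm_pow]
      have : ‖w‖ ≤ ‖z‖ + 1 := (mem_ball_zero_iff.1 hw).le
      gcongr
    exact hd.differentiableAt (Metric.isOpen_ball.mem_nhds (by simp))
  · refine (Summable.of_norm ?_).hasSum
    simpa only [norm_mul, norm_pow] using hbound ‖z‖ (norm_nonneg z)

/-- Diagonal extraction for entire functions vanishing at the origin whose derivatives lie in
the unit ball of the Fock space. -/
theorem exists_subseq_tendsto_fock {h : ℕ → ℂ → ℂ} (hd : ∀ i, Differentiable ℂ (h i))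
    (hF : ∀ i, MemFock (deriv (h i))) (hN : ∀ i, fockNormSq (deriv (h i)) ≤ 1)
    (hz : ∀ i, h i 0 = 0) :
    ∃ φ : ℕ → ℕ, StrictMono φ ∧ ∃ g : ℂ → ℂ, MemFock g ∧
      Tendsto (fun i => fockNormSq (fun z => h (φ i) z - g z)) atTop (nhds 0) := by
  have hsum := fun i => hasSum_taylorCoeff_primitive (hF i)
  have hpos : ∀ i (n : ℕ), 0 ≤ (n : ℝ) * (n.factorial * ‖taylorCoeff (h i) n‖ ^ 2) :=
    fun i n => by positivity
  have hle1 : ∀ i, fockNormSq (deriv (h i)) / Real.pi ≤ 1 := by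
    intro i
    rw [div_le_one Real.pi_pos]
    linarith [hN i, Real.pi_gt_three]
  have hball : ∀ i, taylorCoeff (h i) ∈ Set.univ.pi fun _ : ℕ => Metric.closedBall (0 : ℂ) 1 := by
    intro i n _
    rw [mem_closedBall_zero_iff]
    rcases Nat.eq_zero_or_pos n with rfl | hn
    · simp [taylorCoeff, hz i]
    · have h1 := (le_hasSum (hsum i) n fun m _ => hpos i m).trans (hle1 i)
      have h2 : (1 : ℝ) ≤ n := by exact_mod_cast hn
      have h3 : (1 : ℝ) ≤ n.factorial := by exact_mod_cast n.factorial_pos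
      have h4 : (1 : ℝ) ≤ n * n.factorial := by nlinarith
      have h5 : ‖taylorCoeff (h i) n‖ ^ 2 ≤ 1 := by
        nlinarith [sq_nonneg ‖taylorCoeff (h i) n‖]
      exact (sq_le_one_iff₀ (norm_nonneg _)).1 h5
  obtain ⟨c, -, φ, hφ, hc⟩ :=
    (isCompact_univ_pi fun _ : ℕ => isCompact_closedBall (0 : ℂ) 1).tendsto_subseq hball
  have hcn : ∀ n, Tendsto (fun i => taylorCoeff (h (φ i)) n) atTop (nhds (c n)) :=
    fun n => (tendsto_pi_nhds.1 hc) n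
  have hfin : ∀ s : Finset ℕ, ∑ n ∈ s, (n : ℝ) * (n.factorial * ‖c n‖ ^ 2) ≤ 1 := by
    intro s
    refine le_of_tendsto' (tendsto_finsetSum s fun n _ =>
      (((hcn n).norm.pow 2).const_mul (n.factorial : ℝ)).const_mul (n : ℝ)) fun i => ?_
    exact (sum_le_hasSum s (fun n _ => hpos _ n) (hsum (φ i))).trans (hle1 _)
  have hcs : Summable fun n : ℕ => (n : ℝ) * (n.factorial * ‖c n‖ ^ 2) :=
    summable_of_sum_le (fun n => by positivity) hfin
  have hcs1 : ∑' n : ℕ, (n : ℝ) * (n.factorial * ‖c n‖ ^ 2) ≤ 1 := hcs.tsum_le_of_sum_le hfin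
  have hcs' := summable_of_summable_nat_mul (fun n => by positivity) hcs
  obtain ⟨g, hgd, hg⟩ := exists_entire_of_summable hcs'
  refine ⟨φ, hφ, g, (memFock_iff_summable hgd hg).2 hcs', ?_⟩
  have hdiff : ∀ i z, HasSum (fun n => (taylorCoeff (h (φ i)) n - c n) * z ^ n)
      (h (φ i) z - g z) := by
    intro i z
    simpa only [sub_mul] using (hasSum_taylorCoeff (hd (φ i)) z).sub (hg z)
  have hmaj : ∀ i (n : ℕ), (n : ℝ) * (n.factorial * ‖taylorCoeff (h (φ i)) n - c n‖ ^ 2) ≤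
      2 * ((n : ℝ) * (n.factorial * ‖taylorCoeff (h (φ i)) n‖ ^ 2)) +
        2 * ((n : ℝ) * (n.factorial * ‖c n‖ ^ 2)) := by
    intro i n
    have h1 : ‖taylorCoeff (h (φ i)) n - c n‖ ^ 2 ≤
        2 * ‖taylorCoeff (h (φ i)) n‖ ^ 2 + 2 * ‖c n‖ ^ 2 := by
      have := norm_sub_le (taylorCoeff (h (φ i)) n) (c n)
      nlinarith [sq_nonneg (‖taylorCoeff (h (φ i)) n‖ - ‖c n‖),
        norm_nonneg (taylorCoeff (h (φ i)) n - c n)]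
    calc _ ≤ (n : ℝ) * (n.factorial *
          (2 * ‖taylorCoeff (h (φ i)) n‖ ^ 2 + 2 * ‖c n‖ ^ 2)) := by gcongr
      _ = _ := by ring
  have hmajs := fun i => ((hsum (φ i)).mul_left 2).add (hcs.hasSum.mul_left 2)
  have hds : ∀ i, Summable fun n : ℕ =>
      (n : ℝ) * (n.factorial * ‖taylorCoeff (h (φ i)) n - c n‖ ^ 2) := fun i =>
    (hmajs i).summable.of_nonneg_of_le (fun n => by positivity) (hmaj i)
  have hnorm : ∀ i, fockNormSq (fun z => h (φ i) z - g z) = Real.pi *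
      ∑' n, (n.factorial : ℝ) * ‖taylorCoeff (h (φ i)) n - c n‖ ^ 2 := fun i =>
    fockNormSq_eq_tsum ((memFock_iff_summable ((hd (φ i)).sub hgd) (hdiff i)).2
      (summable_of_summable_nat_mul (fun n => by positivity) (hds i))) (hdiff i)
  simp_rw [hnorm]
  rw [← mul_zero Real.pi]
  refine Tendsto.const_mul _ (tendsto_tsum_zero_of_nat_mul (M := 4)
    (fun i n => by positivity) hds (fun i => ?_) fun n => ?_)
  · refine ((hds i).tsum_le_tsum (hmaj i) (hmajs i).summable).trans ?_
    rw [(hmajs i).tsum_eq]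
    linarith [hle1 (φ i)]
  · simpa using ((((hcn n).sub_const (c n)).norm.pow 2).const_mul (n.factorial : ℝ))

/-- The operator `T` assigning to `f ∈ A²(ℂ, e^{-|z|²})` its unique primitive `h`
(entire, `h' = f`, `h 0 = 0`) maps the Fock space into itself, is linear, and is
compact: the image of the unit ball has sequentially compact closure in the Fock
space. -/
theorem stmt2 :
    -- T maps the Fock space into itself
    (∀ f h : ℂ → ℂ, MemFock f → Differentiable ℂ h → deriv h = f → h 0 = 0 →
      MemFock h) ∧
    -- T is linear (a primitive of a linear combination is the corresponding
    -- linear combination of primitives)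
    (∀ (f g hf hg : ℂ → ℂ) (a b : ℂ), Differentiable ℂ hf → Differentiable ℂ hg →
      deriv hf = f → deriv hg = g →
      deriv (fun z => a * hf z + b * hg z) = fun z => a * f z + b * g z) ∧
    -- T is compact
    (∀ f h : ℕ → ℂ → ℂ,
      (∀ i, MemFock (f i) ∧ fockNormSq (f i) ≤ 1) →
      (∀ i, Differentiable ℂ (h i) ∧ deriv (h i) = f i ∧ h i 0 = 0) →
      ∃ φ : ℕ → ℕ, StrictMono φ ∧ ∃ g : ℂ → ℂ, MemFock g ∧
        Tendsto (fun i => fockNormSq (fun z => h (φ i) z - g z)) atTop (nhds 0)) := by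
  refine ⟨?_, ?_, ?_⟩
  · rintro f h hF hd rfl -
    exact MemFock.primitive hd hF
  · rintro f g hf hg a b hdf hdg rfl rfl
    ext z
    exact (((hdf z).hasDerivAt.const_mul a).add ((hdg z).hasDerivAt.const_mul b)).deriv
  · intro f h hf hh
    have hder : ∀ i, deriv (h i) = f i := fun i => (hh i).2.1
    exact exists_subseq_tendsto_fock (fun i => (hh i).1) (fun i => (hder i).symm ▸ (hf i).1)
      (fun i => (hder i).symm ▸ (hf i).2) fun i => (hh i).2.2
end
end

section
/- Let φ : ℂⁿ → ℝ be a plurisubharmonic C^∞ function. Let u = Σ_{j=1}^n u_j dz_j be a (1,0)-form with coefficients u_j ∈ A²(ℂⁿ, e^{-φ}) such that u ∈ dom(∂) ∩ dom(∂*_φ). Then ‖∂u‖²_φ + ‖∂*_φ u‖²_φ = Σ_{j,k=1}^n ∫_{ℂⁿ} |∂u_j/∂z_k|² e^{-φ} dλ + Σ_{j,k=1}^n ∫_{ℂⁿ} (∂²φ/∂z_k∂z̄_j) u_j \overline{u_k} e^{-φ} dλ − Σ_{j,k=1}^n ( (∂φ/∂z̄_j)u_j − P_φ((∂φ/∂z̄_j)u_j),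 (∂φ/∂z̄_k)u_k )_φ. -/
open MeasureTheory Filter Complex Finset

noncomputable section

/-- Points of `ℂⁿ`. -/
abbrev Cn (n : ℕ) := Fin n → ℂ

/-- The holomorphic partial derivative `∂f/∂z_j` of an entire function. -/
def pdz {n : ℕ} (j : Fin n) (f : Cn n → ℂ) : Cn n → ℂ :=
  fun z => fderiv ℂ f z (Pi.single j 1)

/-- The Wirtinger derivative `∂g/∂z_j` of a (not necessarily holomorphic)
function `g : ℂⁿ → ℂ`. -/
def wdz {n : ℕ} (j : Fin n) (g : Cn n → ℂ) : Cn n → ℂ :=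
  fun z => (fderiv ℝ g z (Pi.single j 1) - Complex.I * fderiv ℝ g z (Pi.single j Complex.I)) / 2

/-- The Wirtinger derivative `∂g/∂z̄_j`. -/
def wdzbar {n : ℕ} (j : Fin n) (g : Cn n → ℂ) : Cn n → ℂ :=
  fun z => (fderiv ℝ g z (Pi.single j 1) + Complex.I * fderiv ℝ g z (Pi.single j Complex.I)) / 2

/-- A real-valued function viewed as a complex-valued one. -/
def cplx {n : ℕ} (φ : Cn n → ℝ) : Cn n → ℂ := fun z => (φ z : ℂ)

/-- The entry `∂²φ/∂z_k ∂z̄_j` of the Levi matrix of `φ`. -/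
def levi {n : ℕ} (φ : Cn n → ℝ) (j k : Fin n) : Cn n → ℂ := wdz k (wdzbar j (cplx φ))

/-- Plurisubharmonicity of a smooth function: the Levi matrix is positive
semidefinite at every point. -/
def PSH {n : ℕ} (φ : Cn n → ℝ) : Prop :=
  ∀ z w : Cn n, 0 ≤ (∑ j, ∑ k, levi φ j k z * w j * (starRingEnd ℂ) (w k)).re

/-- The weight `e^{-φ}`. -/
def wWt {n : ℕ} (φ : Cn n → ℝ) (z : Cn n) : ℝ := Real.exp (-(φ z))

/-- Squared norm `‖f‖²_φ = ∫ |f|² e^{-φ} dλ`. -/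
def wNormSq {n : ℕ} (φ : Cn n → ℝ) (f : Cn n → ℂ) : ℝ := ∫ z : Cn n, ‖f z‖ ^ 2 * wWt φ z

/-- Inner product `(f,g)_φ = ∫ f ḡ e^{-φ} dλ`. -/
def wInner {n : ℕ} (φ : Cn n → ℝ) (f g : Cn n → ℂ) : ℂ :=
  ∫ z : Cn n, f z * (starRingEnd ℂ) (g z) * wWt φ z

/-- Membership in the weighted space of entire functions `A²(ℂⁿ, e^{-φ})`. -/
def MemA {n : ℕ} (φ : Cn n → ℝ) (f : Cn n → ℂ) : Prop :=
  Differentiable ℂ f ∧ Integrable (fun z : Cn n => ‖f z‖ ^ 2 * wWt φ z)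

/-- Membership in `L²(ℂⁿ, e^{-φ})`. -/
def MemL2 {n : ℕ} (φ : Cn n → ℝ) (f : Cn n → ℂ) : Prop :=
  AEStronglyMeasurable f volume ∧ Integrable (fun z : Cn n => ‖f z‖ ^ 2 * wWt φ z)

/-- `Pf` is the Bergman projection `P_φ V` of `V ∈ L²(ℂⁿ, e^{-φ})`: it belongs to
`A²(ℂⁿ, e^{-φ})` and `V - Pf` is orthogonal to `A²(ℂⁿ, e^{-φ})`. -/
def IsBergProj {n : ℕ} (φ : Cn n → ℝ) (V Pf : Cn n → ℂ) : Prop :=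
  MemA φ Pf ∧ ∀ h : Cn n → ℂ, MemA φ h → wInner φ (fun z => V z - Pf z) h = 0

/-- Cauchy's integral formula for a directional derivative of an entire function. -/
lemma fderiv_apply_eq_circle_integral {n : ℕ} {f : Cn n → ℂ} (hf : Differentiable ℂ f)
    (z v : Cn n) :
    fderiv ℂ f z v = (2 * Real.pi * I : ℂ)⁻¹ *
      ∫ θ in (0 : ℝ)..2 * Real.pi,
        (circleMap 0 1 θ)⁻¹ * I * f (z + circleMap 0 1 θ • v) := by
  have hline : ∀ t : ℂ, HasDerivAt (fun s : ℂ => z + s • v) v t := fun t => by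
    simpa using ((hasDerivAt_id t).smul_const v).const_add z
  have hg : Differentiable ℂ (fun t : ℂ => f (z + t • v)) := fun t =>
    ((hf _).hasFDerivAt.comp_hasDerivAt t (hline t)).differentiableAt
  have hd : HasDerivAt (fun t : ℂ => f (z + t • v)) (fderiv ℂ f z v) 0 := by
    have h := (hf (z + (0 : ℂ) • v)).hasFDerivAt.comp_hasDerivAt (0 : ℂ) (hline 0)
    simpa [Function.comp_def] using h
  have hc := (hg.diffContOnCl (s := Metric.ball 0 1)).deriv_eq_smul_circleIntegral one_pos
  rw [hd.deriv, smul_eq_mul] at hc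
  rw [eq_inv_mul_iff_mul_eq₀ two_pi_I_ne_zero, ← hc, circleIntegral]
  simp only [smul_eq_mul, deriv_circleMap]
  refine intervalIntegral.integral_congr fun θ _ => ?_
  have : circleMap 0 1 θ ≠ 0 := circleMap_ne_center one_ne_zero
  simp only [sub_zero]
  field_simp

/-- An entire function of several variables is continuously complex differentiable. -/
lemma Differentiable.contDiff_one_entire {n : ℕ} {f : Cn n → ℂ} (hf : Differentiable ℂ f) :
    ContDiff ℂ 1 f := by
  refine contDiff_one_iff_fderiv.2 ⟨hf, continuous_clm_apply.2 fun v => ?_⟩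
  simp only [fderiv_apply_eq_circle_integral hf]
  refine continuous_const.mul
    (intervalIntegral.continuous_parametric_intervalIntegral_of_continuous' ?_ _ _)
  have hf' := hf.continuous
  have : ∀ θ, circleMap 0 1 θ ≠ 0 := fun θ => circleMap_ne_center one_ne_zero
  have h2 : Continuous fun p : Cn n × ℝ => (circleMap 0 1 p.2)⁻¹ :=
    ((continuous_circleMap 0 1).comp continuous_snd).inv₀ fun p => this _
  simp only [Function.uncurry_def]
  fun_prop

/-- Directional derivatives of an entire function are entire. -/
lemma Differentiable.differentiable_fderiv_apply {n : ℕ} {f : Cn n → ℂ}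
    (hf : Differentiable ℂ f) (v : Cn n) :
    Differentiable ℂ (fun z => fderiv ℂ f z v) := by
  intro z₀
  have hfd : Continuous (fderiv ℂ f) := (contDiff_one_iff_fderiv.1 hf.contDiff_one_entire).2
  have hne : ∀ θ, circleMap 0 1 θ ≠ 0 := fun θ => circleMap_ne_center one_ne_zero
  have hinv : Continuous fun θ : ℝ => (circleMap 0 1 θ)⁻¹ :=
    (continuous_circleMap 0 1).inv₀ hne
  have hf' := hf.continuous
  have hK : IsCompact (Metric.closedBall z₀ (1 + ‖v‖)) := isCompact_closedBall _ _
  obtain ⟨C, hC⟩ := hK.exists_bound_of_continuousOn hfd.continuousOn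
  simp only [fderiv_apply_eq_circle_integral hf]
  refine DifferentiableAt.const_mul ?_ _
  refine (intervalIntegral.hasFDerivAt_integral_of_dominated_of_fderiv_le
    (F' := fun z θ => ((circleMap 0 1 θ)⁻¹ * I) • fderiv ℂ f (z + circleMap 0 1 θ • v))
    (bound := fun _ => C) (Metric.ball_mem_nhds z₀ one_pos)
    (Eventually.of_forall fun z => ?_) ?_ ?_ ?_ ?_ ?_).differentiableAt
  · exact Continuous.aestronglyMeasurable (by fun_prop)
  · exact Continuous.intervalIntegrable (by fun_prop) _ _
  · exact Continuous.aestronglyMeasurable (by fun_prop)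
  · refine Eventually.of_forall fun θ _ z hz => ?_
    have hmem : z + circleMap 0 1 θ • v ∈ Metric.closedBall z₀ (1 + ‖v‖) := by
      rw [mem_closedBall_iff_norm]
      have h1 : ‖z - z₀‖ ≤ 1 := (mem_ball_iff_norm.1 hz).le
      calc ‖z + circleMap 0 1 θ • v - z₀‖ = ‖(z - z₀) + circleMap 0 1 θ • v‖ := by congr 1; abel
        _ ≤ ‖z - z₀‖ + ‖circleMap 0 1 θ • v‖ := norm_add_le _ _
        _ ≤ 1 + ‖v‖ := by
          rw [norm_smul, norm_circleMap_zero]; simpa using h1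
    simpa [norm_smul] using hC _ hmem
  · exact continuous_const.intervalIntegrable _ _
  · refine Eventually.of_forall fun θ _ z _ => ?_
    have h := ((hf (z + circleMap 0 1 θ • v)).hasFDerivAt.comp z
      ((hasFDerivAt_id z).add_const (circleMap 0 1 θ • v)))
    simpa using h.const_mul ((circleMap 0 1 θ)⁻¹ * I)

section Wirtinger

variable {n : ℕ} {f g : Cn n → ℂ} {z : Cn n}

lemma wdz_mul (k : Fin n) (hf : DifferentiableAt ℝ f z) (hg : DifferentiableAt ℝ g z) :
    wdz k (fun w => f w * g w) z = wdz k f z * g z + f z * wdz k g z := by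
  simp only [wdz, fderiv_fun_mul hf hg, add_apply, smul_apply, smul_eq_mul]
  ring

lemma wdzbar_mul (k : Fin n) (hf : DifferentiableAt ℝ f z) (hg : DifferentiableAt ℝ g z) :
    wdzbar k (fun w => f w * g w) z = wdzbar k f z * g z + f z * wdzbar k g z := by
  simp only [wdzbar, fderiv_fun_mul hf hg, add_apply, smul_apply, smul_eq_mul]
  ring

lemma fderiv_real_conj (hf : DifferentiableAt ℝ f z) (v : Cn n) :
    fderiv ℝ (fun w => (starRingEnd ℂ) (f w)) z v = (starRingEnd ℂ) (fderiv ℝ f z v) := by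
  have h := (conjCLE.toContinuousLinearMap.hasFDerivAt (x := f z)).comp z hf.hasFDerivAt
  have h' : HasFDerivAt (fun w => (starRingEnd ℂ) (f w)) _ z := h
  rw [h'.fderiv]
  simp

lemma wdz_conj (k : Fin n) (hf : DifferentiableAt ℝ f z) :
    wdz k (fun w => (starRingEnd ℂ) (f w)) z = (starRingEnd ℂ) (wdzbar k f z) := by
  simp only [wdz, wdzbar, fderiv_real_conj hf, map_div₀, map_add, map_mul, conj_I, map_ofNat]
  ring

lemma wdzbar_conj (k : Fin n) (hf : DifferentiableAt ℝ f z) :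
    wdzbar k (fun w => (starRingEnd ℂ) (f w)) z = (starRingEnd ℂ) (wdz k f z) := by
  simp only [wdz, wdzbar, fderiv_real_conj hf, map_div₀, map_sub, map_mul, conj_I, map_ofNat]
  ring

lemma fderiv_real_single_I (j : Fin n) (hf : DifferentiableAt ℂ f z) :
    fderiv ℝ f z (Pi.single j I) = I * fderiv ℝ f z (Pi.single j 1) := by
  rw [hf.fderiv_restrictScalars ℝ]
  have : (Pi.single j I : Cn n) = I • Pi.single j 1 := by
    rw [← Pi.single_smul, smul_eq_mul, mul_one]
  simp [this]

lemma wdz_eq_pdz (j : Fin n) (hf : DifferentiableAt ℂ f z) : wdz j f z = pdz j f z := by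
  rw [wdz, fderiv_real_single_I j hf, ← mul_assoc, I_mul_I, hf.fderiv_restrictScalars ℝ, pdz]
  simp

lemma wdzbar_eq_zero (j : Fin n) (hf : DifferentiableAt ℂ f z) : wdzbar j f z = 0 := by
  rw [wdzbar, fderiv_real_single_I j hf, ← mul_assoc, I_mul_I]
  simp

lemma fderiv_cplx {φ : Cn n → ℝ} (hφ : DifferentiableAt ℝ φ z) (v : Cn n) :
    fderiv ℝ (cplx φ) z v = (fderiv ℝ φ z v : ℂ) := by
  have h := (ofRealCLM.hasFDerivAt (x := φ z)).comp z hφ.hasFDerivAt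
  have h' : HasFDerivAt (cplx φ) _ z := h
  rw [h'.fderiv]
  simp

lemma wdz_cplx {φ : Cn n → ℝ} (hφ : DifferentiableAt ℝ φ z) (j : Fin n) :
    wdz j (cplx φ) z = (starRingEnd ℂ) (wdzbar j (cplx φ) z) := by
  simp only [wdz, wdzbar, fderiv_cplx hφ, map_div₀, map_add, map_mul, conj_I, map_ofNat,
    conj_ofReal]
  ring

lemma fderiv_wWt {φ : Cn n → ℝ} (hφ : DifferentiableAt ℝ φ z) (v : Cn n) :
    fderiv ℝ (wWt φ) z v = -(fderiv ℝ φ z v) * wWt φ z := by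
  have h : HasFDerivAt (wWt φ) _ z := hφ.hasFDerivAt.neg.exp
  rw [h.fderiv]
  simp [wWt, mul_comm]

lemma differentiableAt_wWt {φ : Cn n → ℝ} (hφ : DifferentiableAt ℝ φ z) :
    DifferentiableAt ℝ (wWt φ) z :=
  hφ.neg.exp

lemma wdz_cplx_wWt {φ : Cn n → ℝ} (hφ : DifferentiableAt ℝ φ z) (j : Fin n) :
    wdz j (cplx (wWt φ)) z = -(starRingEnd ℂ) (wdzbar j (cplx φ) z) * wWt φ z := by
  rw [← wdz_cplx hφ]
  simp only [wdz, fderiv_cplx (differentiableAt_wWt hφ), fderiv_cplx hφ, fderiv_wWt hφ]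
  push_cast
  ring

lemma wdzbar_cplx_wWt {φ : Cn n → ℝ} (hφ : DifferentiableAt ℝ φ z) (j : Fin n) :
    wdzbar j (cplx (wWt φ)) z = -wdzbar j (cplx φ) z * wWt φ z := by
  simp only [wdzbar, fderiv_cplx (differentiableAt_wWt hφ), fderiv_cplx hφ, fderiv_wWt hφ]
  push_cast
  ring

lemma ContDiff.fderiv_real_apply {m : WithTop ℕ∞} (hg : ContDiff ℝ (m + 1) g) (v : Cn n) :
    ContDiff ℝ m (fun z => fderiv ℝ g z v) :=
  (hg.fderiv_right le_rfl).clm_apply contDiff_const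

lemma ContDiff.wdz {m : WithTop ℕ∞} (hg : ContDiff ℝ (m + 1) g) (j : Fin n) :
    ContDiff ℝ m (wdz j g) :=
  ((hg.fderiv_real_apply _).sub (contDiff_const.mul (hg.fderiv_real_apply _))).div_const _

lemma ContDiff.wdzbar {m : WithTop ℕ∞} (hg : ContDiff ℝ (m + 1) g) (j : Fin n) :
    ContDiff ℝ m (wdzbar j g) :=
  ((hg.fderiv_real_apply _).add (contDiff_const.mul (hg.fderiv_real_apply _))).div_const _

lemma ContDiff.cplx {m : WithTop ℕ∞} {φ : Cn n → ℝ} (hφ : ContDiff ℝ m φ) :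
    ContDiff ℝ m (cplx φ) :=
  ofRealCLM.contDiff.comp hφ

lemma ContDiff.wWt {m : WithTop ℕ∞} {φ : Cn n → ℝ} (hφ : ContDiff ℝ m φ) :
    ContDiff ℝ m (wWt φ) :=
  hφ.neg.exp

lemma ContDiff.conj {m : WithTop ℕ∞} (hf : ContDiff ℝ m f) :
    ContDiff ℝ m (fun z => (starRingEnd ℂ) (f z)) :=
  conjCLE.contDiff.comp hf

/-- Integration by parts against a compactly supported function. -/
lemma integral_mul_fderiv_of_hasCompactSupport (hf : ContDiff ℝ 1 f) (hg : ContDiff ℝ 1 g)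
    (hgc : HasCompactSupport g) (v : Cn n) :
    Integrable (fun z => fderiv ℝ f z v * g z) ∧ Integrable (fun z => f z * fderiv ℝ g z v) ∧
      ∫ z, f z * fderiv ℝ g z v = -∫ z, fderiv ℝ f z v * g z := by
  have hf' : Continuous fun z => fderiv ℝ f z v := (hf.fderiv_real_apply (m := 0) v).continuous
  have hg' : Continuous fun z => fderiv ℝ g z v := (hg.fderiv_real_apply (m := 0) v).continuous
  have hgc' : HasCompactSupport fun z => fderiv ℝ g z v := hgc.fderiv_apply ℝ v
  have h1 : Integrable (fun z => fderiv ℝ f z v * g z) :=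
    (hf'.mul hg.continuous).integrable_of_hasCompactSupport hgc.mul_left
  have h2 : Integrable (fun z => f z * fderiv ℝ g z v) :=
    (hf.continuous.mul hg').integrable_of_hasCompactSupport hgc'.mul_left
  refine ⟨h1, h2, integral_mul_fderiv_eq_neg_fderiv_mul_of_integrable h1 h2
    ((hf.continuous.mul hg.continuous).integrable_of_hasCompactSupport hgc.mul_left)
    (fun x _ => hf.differentiable one_ne_zero x) (fun x _ => hg.differentiable one_ne_zero x)⟩

lemma integral_wdz_mul (hf : ContDiff ℝ 1 f) (hg : ContDiff ℝ 1 g)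
    (hgc : HasCompactSupport g) (k : Fin n) :
    Integrable (fun z => wdz k f z * g z) ∧ Integrable (fun z => f z * wdz k g z) ∧
      ∫ z, wdz k f z * g z = -∫ z, f z * wdz k g z := by
  obtain ⟨a1, a2, a3⟩ := integral_mul_fderiv_of_hasCompactSupport hf hg hgc (Pi.single k 1)
  obtain ⟨b1, b2, b3⟩ := integral_mul_fderiv_of_hasCompactSupport hf hg hgc (Pi.single k I)
  have e1 : ∀ z, wdz k f z * g z = (1 / 2) * (fderiv ℝ f z (Pi.single k 1) * g z)
      - (I / 2) * (fderiv ℝ f z (Pi.single k I) * g z) := fun z => by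
    simp only [wdz]; ring
  have e2 : ∀ z, f z * wdz k g z = (1 / 2) * (f z * fderiv ℝ g z (Pi.single k 1))
      - (I / 2) * (f z * fderiv ℝ g z (Pi.single k I)) := fun z => by
    simp only [wdz]; ring
  simp only [e1, e2]
  refine ⟨(a1.const_mul _).sub (b1.const_mul _), (a2.const_mul _).sub (b2.const_mul _), ?_⟩
  rw [integral_sub (a1.const_mul _) (b1.const_mul _), integral_sub (a2.const_mul _)
    (b2.const_mul _)]
  simp only [integral_const_mul, a3, b3]
  ring

lemma integral_wdzbar_mul (hf : ContDiff ℝ 1 f) (hg : ContDiff ℝ 1 g)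
    (hgc : HasCompactSupport g) (k : Fin n) :
    Integrable (fun z => wdzbar k f z * g z) ∧ Integrable (fun z => f z * wdzbar k g z) ∧
      ∫ z, wdzbar k f z * g z = -∫ z, f z * wdzbar k g z := by
  obtain ⟨a1, a2, a3⟩ := integral_mul_fderiv_of_hasCompactSupport hf hg hgc (Pi.single k 1)
  obtain ⟨b1, b2, b3⟩ := integral_mul_fderiv_of_hasCompactSupport hf hg hgc (Pi.single k I)
  have e1 : ∀ z, wdzbar k f z * g z = (1 / 2) * (fderiv ℝ f z (Pi.single k 1) * g z)
      + (I / 2) * (fderiv ℝ f z (Pi.single k I) * g z) := fun z => by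
    simp only [wdzbar]; ring
  have e2 : ∀ z, f z * wdzbar k g z = (1 / 2) * (f z * fderiv ℝ g z (Pi.single k 1))
      + (I / 2) * (f z * fderiv ℝ g z (Pi.single k I)) := fun z => by
    simp only [wdzbar]; ring
  simp only [e1, e2]
  refine ⟨(a1.const_mul _).add (b1.const_mul _), (a2.const_mul _).add (b2.const_mul _), ?_⟩
  rw [integral_add (a1.const_mul _) (b1.const_mul _), integral_add (a2.const_mul _)
    (b2.const_mul _)]
  simp only [integral_const_mul, a3, b3]
  ring

lemma norm_fderiv_single_le {χ : Cn n → ℝ} {δ : ℝ} (hχ : ‖fderiv ℝ χ z‖ ≤ δ) (j : Fin n)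
    {c : ℂ} (hc : ‖c‖ = 1) : |fderiv ℝ χ z (Pi.single j c)| ≤ δ := by
  have h := (fderiv ℝ χ z).le_opNorm (Pi.single j c)
  rw [Pi.norm_single, hc, mul_one] at h
  exact h.trans hχ

lemma norm_wdz_cplx_sq_le {χ : Cn n → ℝ} {δ : ℝ} (hd : DifferentiableAt ℝ χ z) (h0 : 0 ≤ χ z)
    (hχ : ‖fderiv ℝ χ z‖ ≤ δ) (j : Fin n) :
    ‖wdz j (cplx fun w => χ w ^ 2) z‖ ≤ 2 * δ * χ z ∧
      ‖wdzbar j (cplx fun w => χ w ^ 2) z‖ ≤ 2 * δ * χ z := by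
  have hf : ∀ v, fderiv ℝ (fun w => χ w ^ 2) z v = 2 * χ z * fderiv ℝ χ z v := fun v => by
    rw [fderiv_fun_pow 2 hd]; simp
  have hnorm : ∀ c : ℂ, ‖c‖ = 1 →
      ‖((2 * χ z * fderiv ℝ χ z (Pi.single j c) : ℝ) : ℂ)‖ ≤ 2 * δ * χ z := fun c hc => by
    rw [norm_real, Real.norm_eq_abs, abs_mul, abs_of_nonneg (by positivity)]
    nlinarith [norm_fderiv_single_le hχ j hc]
  have h1 := hnorm 1 norm_one
  have h2 := hnorm I norm_I
  have hc := wdz_cplx (hd.fun_pow 2) j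
  have hbar : ‖wdzbar j (cplx fun w => χ w ^ 2) z‖ ≤ 2 * δ * χ z := by
    simp only [wdzbar, fderiv_cplx (hd.fun_pow 2), hf]
    rw [norm_div, RCLike.norm_ofNat, div_le_iff₀ two_pos]
    refine (norm_add_le _ _).trans ?_
    rw [norm_mul, norm_I, one_mul]
    linarith
  refine ⟨?_, hbar⟩
  rw [hc, RCLike.norm_conj]
  exact hbar

end Wirtinger

/-- Smooth cutoff functions exhausting `ℂⁿ` whose gradients tend uniformly to zero. -/
lemma exists_cutoff (n : ℕ) :
    ∃ (χ : ℕ → Cn n → ℝ) (δ : ℕ → ℝ), Tendsto δ atTop (nhds 0) ∧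
      (∀ m, ContDiff ℝ 1 (χ m)) ∧ (∀ m, HasCompactSupport (χ m)) ∧
      (∀ m z, 0 ≤ χ m z) ∧ (∀ m z, χ m z ≤ 1) ∧
      (∀ z, Tendsto (fun m => χ m z) atTop (nhds 1)) ∧ ∀ m z, ‖fderiv ℝ (χ m) z‖ ≤ δ m := by
  let f : ContDiffBump (0 : Cn n) := ⟨1, 2, one_pos, one_lt_two⟩
  have hfs : ContDiff ℝ 1 f := f.contDiff
  obtain ⟨C, hC⟩ := (hfs.continuous_fderiv one_ne_zero).bounded_above_of_compact_support
    (f.hasCompactSupport.fderiv ℝ)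
  have hpos : ∀ m : ℕ, (0 : ℝ) < 1 / ((m : ℝ) + 1) := fun m => Nat.one_div_pos_of_nat
  refine ⟨fun m z => f ((1 / ((m : ℝ) + 1)) • z), fun m => C * (1 / ((m : ℝ) + 1)), ?_, ?_, ?_,
    fun m z => f.nonneg, fun m z => f.le_one, ?_, ?_⟩
  · simpa using tendsto_one_div_add_atTop_nhds_zero_nat.const_mul C
  · exact fun m => hfs.comp (contDiff_id.const_smul _)
  · exact fun m => f.hasCompactSupport.comp_homeomorph (Homeomorph.smulOfNeZero _ (hpos m).ne')
  · intro z
    have h : Tendsto (fun m : ℕ => (1 / ((m : ℝ) + 1)) • z) atTop (nhds 0) := by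
      simpa using (tendsto_one_div_add_atTop_nhds_zero_nat (𝕜 := ℝ)).smul_const z
    have hf0 : f (0 : Cn n) = 1 := f.one_of_mem_closedBall (by simp [f.rIn_pos.le])
    simpa [hf0, Function.comp_def] using (hfs.continuous.tendsto 0).comp h
  · intro m z
    have h := ((hfs.differentiable one_ne_zero) ((1 / ((m : ℝ) + 1)) • z)).hasFDerivAt.comp z
      ((hasFDerivAt_id z).const_smul (1 / ((m : ℝ) + 1)))
    have h' : HasFDerivAt (fun z => f ((1 / ((m : ℝ) + 1)) • z)) _ z := h
    rw [h'.fderiv]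
    refine (ContinuousLinearMap.opNorm_comp_le _ _).trans ?_
    refine mul_le_mul (hC _) ?_ (norm_nonneg _) ((norm_nonneg _).trans (hC 0))
    rw [norm_smul, Real.norm_of_nonneg (hpos m).le]
    exact mul_le_of_le_one_right (hpos m).le ContinuousLinearMap.norm_id_le

/-- A nonnegative continuous function whose cut-off integrals agree with those of an integrable
function, up to an error absorbed in the limit, is integrable with the same integral. -/
lemma integral_eq_of_cutoff {n : ℕ} {H B : Cn n → ℝ} (hH : Continuous H) (hH0 : ∀ z, 0 ≤ H z)
    (hB : Integrable B) {η : ℕ → Cn n → ℝ} (hη : ∀ m, Continuous (η m))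
    (hηc : ∀ m, HasCompactSupport (η m)) (hη0 : ∀ m z, 0 ≤ η m z) (hη1 : ∀ m z, η m z ≤ 1)
    (hηt : ∀ z, Tendsto (fun m => η m z) atTop (nhds 1)) {δ : ℕ → ℝ}
    (hδ : Tendsto δ atTop (nhds 0)) {K : ℝ}
    (h : ∀ m, |∫ z, η m z * (H z - B z)| ≤ δ m * (K + ∫ z, η m z * H z)) :
    Integrable H ∧ ∫ z, H z = ∫ z, B z := by
  have hηH : ∀ m, Integrable fun z => η m z * H z := fun m =>
    ((hη m).mul hH).integrable_of_hasCompactSupport (hηc m).mul_right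
  have hdom : ∀ F : Cn n → ℝ, Integrable F →
      (∀ m, Integrable fun z => η m z * F z) ∧
      Tendsto (fun m => ∫ z, η m z * F z) atTop (nhds (∫ z, F z)) := fun F hF => by
    have hb : ∀ m z, ‖η m z * F z‖ ≤ ‖F z‖ := fun m z => by
      rw [norm_mul, Real.norm_of_nonneg (hη0 m z)]
      exact mul_le_of_le_one_left (norm_nonneg _) (hη1 m z)
    have hm : ∀ m, AEStronglyMeasurable (fun z => η m z * F z) volume := fun m =>
      (hη m).aestronglyMeasurable.mul hF.1
    refine ⟨fun m => hF.mono (hm m) (Eventually.of_forall (hb m)), ?_⟩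
    refine tendsto_integral_of_dominated_convergence (fun z => ‖F z‖) hm hF.norm
      (fun m => Eventually.of_forall (hb m)) (Eventually.of_forall fun z => ?_)
    simpa using (hηt z).mul_const (F z)
  obtain ⟨hBm, hBt⟩ := hdom B hB
  have hdiff : ∀ m, |(∫ z, η m z * H z) - ∫ z, η m z * B z| ≤
      δ m * (K + ∫ z, η m z * H z) := fun m => by
    rw [← integral_sub (hηH m) (hBm m)]
    simpa only [mul_sub] using h m
  have ha0 : ∀ m, 0 ≤ ∫ z, η m z * H z := fun m =>
    integral_nonneg fun z => mul_nonneg (hη0 m z) (hH0 z)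
  obtain ⟨L, hL⟩ : ∃ L, ∀ᶠ m in atTop, ∫ z, η m z * H z ≤ L := by
    refine ⟨2 * (∫ z, B z) + 2 + |K|, ?_⟩
    filter_upwards [hδ.eventually (gt_mem_nhds (show (0 : ℝ) < 1 / 2 by norm_num)),
      hδ.eventually (lt_mem_nhds (show (-1 / 2 : ℝ) < 0 by norm_num)),
      hBt.eventually (gt_mem_nhds (lt_add_one (∫ z, B z)))] with m h1 h2 h3
    have h4 := (le_abs_self _).trans (hdiff m)
    have h5 : δ m * K ≤ |K| / 2 := by
      refine (le_abs_self _).trans ?_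
      rw [abs_mul]
      have : |δ m| ≤ 1 / 2 := abs_le.2 ⟨by linarith, h1.le⟩
      nlinarith [abs_nonneg K]
    nlinarith [ha0 m]
  have hHi : Integrable H := by
    refine ⟨hH.aestronglyMeasurable, ?_⟩
    rw [hasFiniteIntegral_iff_ofReal (Eventually.of_forall hH0)]
    have hlim : ∀ z, liminf (fun m => ENNReal.ofReal (η m z * H z)) atTop
        = ENNReal.ofReal (H z) := fun z => by
      refine Tendsto.liminf_eq (ENNReal.tendsto_ofReal ?_)
      simpa using (hηt z).mul_const (H z)
    calc ∫⁻ z, ENNReal.ofReal (H z)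
        = ∫⁻ z, liminf (fun m => ENNReal.ofReal (η m z * H z)) atTop := by simp only [hlim]
      _ ≤ liminf (fun m => ∫⁻ z, ENNReal.ofReal (η m z * H z)) atTop :=
        lintegral_liminf_le fun m => ((hη m).mul hH).measurable.ennreal_ofReal
      _ ≤ ENNReal.ofReal L := by
        refine liminf_le_of_frequently_le' (Eventually.frequently ?_)
        filter_upwards [hL] with m hm
        rw [← ofReal_integral_eq_lintegral_ofReal (hηH m)
          (Eventually.of_forall fun z => mul_nonneg (hη0 m z) (hH0 z))]
        exact ENNReal.ofReal_le_ofReal hm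
      _ < ⊤ := ENNReal.ofReal_lt_top
  have hHt := (hdom H hHi).2
  refine ⟨hHi, sub_eq_zero.1 (tendsto_nhds_unique (hHt.sub hBt) ?_)⟩
  refine squeeze_zero_norm (fun m => (Real.norm_eq_abs _).trans_le (hdiff m)) ?_
  simpa using hδ.mul (hHt.const_add K)

/-- Polarization of the squared norm of the antisymmetrization of a matrix. -/
lemma sum_Ioi_norm_sub_sq {n : ℕ} (a : Fin n → Fin n → ℂ) :
    ∑ j, ∑ k ∈ Finset.Ioi j, ‖a j k - a k j‖ ^ 2
      = (∑ j, ∑ k, ‖a j k‖ ^ 2) - ∑ j, ∑ k, (a j k * (starRingEnd ℂ) (a k j)).re := by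
  have hF : ∀ j k, ‖a j k - a k j‖ ^ 2
      = ‖a j k‖ ^ 2 + ‖a k j‖ ^ 2 - 2 * (a j k * (starRingEnd ℂ) (a k j)).re := fun j k => by
    rw [← normSq_eq_norm_sq, ← normSq_eq_norm_sq, ← normSq_eq_norm_sq, normSq_sub]
  have h2 : 2 * ∑ j, ∑ k ∈ Finset.Ioi j, ‖a j k - a k j‖ ^ 2
      = ∑ j, ∑ k, ‖a j k - a k j‖ ^ 2 := by
    have h := Finset.sum_sum_Ioi_add_eq_sum_sum_off_diag (fun j k : Fin n => ‖a j k - a k j‖ ^ 2)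
    have hsym : ∀ j k, ‖a k j - a j k‖ ^ 2 = ‖a j k - a k j‖ ^ 2 := fun j k => by
      rw [norm_sub_rev]
    simp only [hsym, ← two_mul, ← Finset.mul_sum] at h
    rw [h]
    refine Finset.sum_congr rfl fun j _ => Finset.sum_subset (Finset.subset_univ _) ?_
    intro k _ hk
    have : k = j := by simpa using hk
    simp [this]
  have hswap : ∑ j, ∑ k, ‖a k j‖ ^ 2 = ∑ j, ∑ k, ‖a j k‖ ^ 2 := Finset.sum_comm
  simp only [hF, Finset.sum_sub_distrib, Finset.sum_add_distrib, hswap, ← Finset.mul_sum] at h2 ⊢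
  linarith

lemma integrable_sum_sum {n : ℕ} {E : Type*} [NormedAddCommGroup E]
    {c : Fin n → Fin n → Cn n → E} (hc : ∀ j k, Integrable (c j k)) :
    Integrable fun z => ∑ j, ∑ k, c j k z :=
  integrable_finsetSum _ fun j _ => integrable_finsetSum _ fun k _ => hc j k

lemma integral_sum_sum {n : ℕ} {E : Type*} [NormedAddCommGroup E] [NormedSpace ℝ E]
    {c : Fin n → Fin n → Cn n → E} (hc : ∀ j k, Integrable (c j k)) :
    ∫ z, ∑ j, ∑ k, c j k z = ∑ j, ∑ k, ∫ z, c j k z := by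
  rw [integral_finsetSum _ fun j _ => integrable_finsetSum _ fun k _ => hc j k]
  exact Finset.sum_congr rfl fun j _ => integral_finsetSum _ fun k _ => hc j k

lemma integrable_sum_sum_re {n : ℕ} {c : Fin n → Fin n → Cn n → ℂ}
    (hc : ∀ j k, Integrable (c j k)) : Integrable fun z => ∑ j, ∑ k, (c j k z).re :=
  integrable_sum_sum fun j k => (hc j k).re

lemma re_sum_integral {n : ℕ} {c : Fin n → Fin n → Cn n → ℂ} (hc : ∀ j k, Integrable (c j k)) :
    (∑ j, ∑ k, ∫ z, c j k z).re = ∫ z, ∑ j, ∑ k, (c j k z).re := by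
  rw [← integral_sum_sum hc]
  refine (integral_re (integrable_sum_sum hc)).symm.trans ?_
  simp

section Weighted

variable {n : ℕ} {φ : Cn n → ℝ}

lemma wWt_pos (z : Cn n) : 0 < wWt φ z := Real.exp_pos _

lemma MemA.memL2 {f : Cn n → ℂ} (hf : MemA φ f) : MemL2 φ f :=
  ⟨hf.1.continuous.aestronglyMeasurable, hf.2⟩

lemma MemL2.integrable_mul_conj (hφ : Continuous φ) {f g : Cn n → ℂ} (hf : MemL2 φ f)
    (hg : MemL2 φ g) :
    Integrable fun z => f z * (starRingEnd ℂ) (g z) * wWt φ z := by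
  have hw : Continuous fun z => (wWt φ z : ℂ) :=
    continuous_ofReal.comp (Real.continuous_exp.comp hφ.neg)
  refine (hf.2.add hg.2).mono
    ((hf.1.mul (continuous_conj.comp_aestronglyMeasurable hg.1)).mul hw.aestronglyMeasurable)
    (Eventually.of_forall fun z => ?_)
  have hpos := (wWt_pos (φ := φ) z).le
  simp only [Pi.add_apply, norm_mul, RCLike.norm_conj, norm_real, Real.norm_of_nonneg hpos]
  rw [Real.norm_of_nonneg (by positivity), ← add_mul]
  refine mul_le_mul_of_nonneg_right ?_ hpos
  nlinarith [sq_nonneg (‖f z‖ - ‖g z‖), sq_nonneg (‖f z‖ + ‖g z‖)]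

lemma MemL2.sub (hφ : Continuous φ) {f g : Cn n → ℂ} (hf : MemL2 φ f) (hg : MemL2 φ g) :
    MemL2 φ fun z => f z - g z := by
  have hw : Continuous (wWt φ) := Real.continuous_exp.comp hφ.neg
  refine ⟨hf.1.sub hg.1, ((hf.2.add hg.2).const_mul 2).mono
    (((hf.1.sub hg.1).norm.pow 2).mul hw.aestronglyMeasurable) (Eventually.of_forall fun z => ?_)⟩
  have hpos := (wWt_pos (φ := φ) z).le
  simp only [Pi.add_apply]
  rw [Real.norm_of_nonneg (by positivity), Real.norm_of_nonneg (by positivity), ← add_mul,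
    ← mul_assoc]
  refine mul_le_mul_of_nonneg_right ?_ hpos
  have h := norm_sub_le (f z) (g z)
  nlinarith [sq_nonneg (‖f z‖ - ‖g z‖), norm_nonneg (f z - g z)]

lemma norm_sq_sum_eq {ι : Type*} [Fintype ι] (a : ι → ℂ) :
    ‖∑ j, a j‖ ^ 2 = ∑ j, ∑ k, (a j * (starRingEnd ℂ) (a k)).re := by
  rw [← normSq_eq_norm_sq, ← ofReal_re (normSq _), ← mul_conj, map_sum, Finset.sum_mul_sum]
  simp only [re_sum]

lemma MemL2.integrable_norm_sq_sum (hφ : Continuous φ) {v : Fin n → Cn n → ℂ}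
    (hv : ∀ j, MemL2 φ (v j)) : Integrable fun z => ‖∑ j, v j z‖ ^ 2 * wWt φ z := by
  refine (integrable_sum_sum_re fun j k => (hv j).integrable_mul_conj hφ (hv k)).congr
    (Eventually.of_forall fun z => ?_)
  simp only [norm_sq_sum_eq, Finset.sum_mul]
  simp

/-- Pythagoras for the Bergman projection of a sum. -/
lemma wNormSq_sum_bergProj (hφ : Continuous φ) {v Pv : Fin n → Cn n → ℂ}
    (hv : ∀ j, MemL2 φ (v j)) (hPv : ∀ j, IsBergProj φ (v j) (Pv j)) :
    wNormSq φ (fun z => ∑ j, Pv j z) = (∫ z, ‖∑ j, v j z‖ ^ 2 * wWt φ z)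
      - (∑ j, ∑ k, wInner φ (fun z => v j z - Pv j z) (v k)).re := by
  have hP : ∀ j, MemL2 φ (Pv j) := fun j => (hPv j).1.memL2
  have hd : ∀ j, MemL2 φ fun z => v j z - Pv j z := fun j => (hv j).sub hφ (hP j)
  have h0 : (∑ j, ∑ k, wInner φ (fun z => v j z - Pv j z) (Pv k)).re = 0 := by
    simp [fun j k => (hPv j).2 (Pv k) (hPv k).1]
  have i1 := fun j k => (hd j).integrable_mul_conj hφ (hv k)
  have i2 := fun j k => (hd j).integrable_mul_conj hφ (hP k)
  have j1 := integrable_sum_sum_re i1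
  have j2 := integrable_sum_sum_re i2
  simp only [wInner] at h0 ⊢
  rw [re_sum_integral i2] at h0
  rw [re_sum_integral i1, ← integral_sub (MemL2.integrable_norm_sq_sum hφ hv) j1, wNormSq,
    ← sub_zero (∫ z, _ - _), ← h0, ← integral_sub ((MemL2.integrable_norm_sq_sum hφ hv).sub' j1) j2]
  congr 1
  ext z
  have key : ∀ S Q : ℂ, ‖Q‖ ^ 2 = ‖S‖ ^ 2 - ((S - Q) * (starRingEnd ℂ) S).re
      - ((S - Q) * (starRingEnd ℂ) Q).re := fun S Q => by
    simp only [← normSq_eq_norm_sq, normSq_apply, mul_re, sub_re, sub_im, conj_re, conj_im]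
    ring
  have hs : ∀ g : Fin n → ℂ, ∑ j, ∑ k, ((v j z - Pv j z) * (starRingEnd ℂ) (g k) * wWt φ z).re
      = (((∑ j, v j z) - ∑ j, Pv j z) * (starRingEnd ℂ) (∑ k, g k)).re * wWt φ z := fun g => by
    rw [← re_mul_ofReal, ← Finset.sum_sub_distrib, map_sum, Finset.sum_mul_sum]
    simp only [Finset.sum_mul, re_sum]
  rw [hs fun k => v k z, hs fun k => Pv k z, key (∑ j, v j z) (∑ j, Pv j z)]
  ring

/-- Localized integration by parts for a single pair of indices, with the error term estimated. -/
lemma norm_integral_cutoff_le (hφ : ContDiff ℝ (⊤ : ℕ∞) φ) {f g : Cn n → ℂ}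
    (hf : MemA φ f) (hg : MemA φ g) (j k : Fin n)
    (hvf : MemL2 φ fun z => wdzbar j (cplx φ) z * f z)
    {χ : Cn n → ℝ} {δ : ℝ} (hχ : ContDiff ℝ 1 χ) (hχc : HasCompactSupport χ)
    (hχ0 : ∀ z, 0 ≤ χ z) (hχ1 : ∀ z, χ z ≤ 1) (hδ : ∀ z, ‖fderiv ℝ χ z‖ ≤ δ) :
    ‖∫ z, (levi φ j k z * f z * (starRingEnd ℂ) (g z)
        - (wdzbar j (cplx φ) z * f z) * (starRingEnd ℂ) (wdzbar k (cplx φ) z * g z)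
        + pdz k f z * (starRingEnd ℂ) (pdz j g z)) * wWt φ z * (χ z ^ 2 : ℝ)‖
      ≤ ∫ z, δ * (‖wdzbar j (cplx φ) z * f z‖ ^ 2 * wWt φ z + 2 * (‖g z‖ ^ 2 * wWt φ z)
        + χ z ^ 2 * (‖pdz k f z‖ ^ 2 * wWt φ z)) := by
  have hfR : ContDiff ℝ 1 f := hf.1.contDiff_one_entire.restrict_scalars ℝ
  have hgR : ContDiff ℝ 1 g := hg.1.contDiff_one_entire.restrict_scalars ℝ
  have hp : Differentiable ℂ (pdz k f) := hf.1.differentiable_fderiv_apply _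
  have hpR : ContDiff ℝ 1 (pdz k f) := hp.contDiff_one_entire.restrict_scalars ℝ
  have hφ1 : ContDiff ℝ 1 φ := hφ.of_le (mod_cast le_top)
  have hφ2 : ContDiff ℝ (1 + 1) φ := by
    simpa [one_add_one_eq_two] using contDiff_infty.1 hφ 2
  have hb : ContDiff ℝ 1 (wdzbar j (cplx φ)) := hφ2.cplx.wdzbar j
  have hwt : ContDiff ℝ 1 (cplx (wWt φ)) := hφ1.wWt.cplx
  have hη : ContDiff ℝ 1 (cplx fun z => χ z ^ 2) := (hχ.pow 2).cplx
  have hηc : HasCompactSupport (cplx fun z => χ z ^ 2) :=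
    hχc.comp_left (g := fun t : ℝ => ((t ^ 2 : ℝ) : ℂ)) (by simp)
  have hX : ContDiff ℝ 1 fun z => wdzbar j (cplx φ) z * f z * (starRingEnd ℂ) (g z)
      * cplx (wWt φ) z := ((hb.mul hfR).mul hgR.conj).mul hwt
  have hY : ContDiff ℝ 1 fun z => pdz k f z * (starRingEnd ℂ) (g z) * cplx (wWt φ) z :=
    (hpR.mul hgR.conj).mul hwt
  obtain ⟨a1, a2, a3⟩ := integral_wdz_mul hX hη hηc k
  obtain ⟨b1, b2, b3⟩ := integral_wdzbar_mul hY hη hηc j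
  have hid : ∀ z, (levi φ j k z * f z * (starRingEnd ℂ) (g z)
        - (wdzbar j (cplx φ) z * f z) * (starRingEnd ℂ) (wdzbar k (cplx φ) z * g z)
        + pdz k f z * (starRingEnd ℂ) (pdz j g z)) * wWt φ z * (χ z ^ 2 : ℝ)
      = wdz k (fun z => wdzbar j (cplx φ) z * f z * (starRingEnd ℂ) (g z)
          * cplx (wWt φ) z) z * cplx (fun z => χ z ^ 2) z
        + wdzbar j (fun z => pdz k f z * (starRingEnd ℂ) (g z) * cplx (wWt φ) z) z
          * cplx (fun z => χ z ^ 2) z := fun z => by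
    have df := hfR.differentiable one_ne_zero z
    have dg := hgR.differentiable one_ne_zero z
    have dg' := hgR.conj.differentiable one_ne_zero z
    have dp := hpR.differentiable one_ne_zero z
    have db := hb.differentiable one_ne_zero z
    have dw := hwt.differentiable one_ne_zero z
    have dφ := hφ1.differentiable one_ne_zero z
    rw [wdz_mul k ((db.fun_mul df).fun_mul dg') dw, wdz_mul k (db.fun_mul df) dg', wdz_mul k db df,
      wdz_conj k dg, wdz_eq_pdz k (hf.1 z), wdzbar_eq_zero k (hg.1 z), wdz_cplx_wWt dφ,
      wdzbar_mul j (dp.fun_mul dg') dw, wdzbar_mul j dp dg', wdzbar_conj j dg, wdz_eq_pdz j (hg.1 z),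
      wdzbar_eq_zero j (hp z), wdzbar_cplx_wWt dφ]
    simp only [levi, cplx, map_mul, map_zero]
    ring
  simp only [hid]
  rw [integral_add a1 b1, a3, b3, ← neg_add, norm_neg, ← integral_add a2 b2]
  have hgcont : Continuous fun z => χ z ^ 2 * (‖pdz k f z‖ ^ 2 * wWt φ z) :=
    (hχ.continuous.pow 2).mul ((hpR.continuous.norm.pow 2).mul hφ1.wWt.continuous)
  have hgi : Integrable fun z => χ z ^ 2 * (‖pdz k f z‖ ^ 2 * wWt φ z) :=
    hgcont.integrable_of_hasCompactSupport
      (hχc.comp_left (g := fun t : ℝ => t ^ 2) (by simp)).mul_right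
  refine norm_integral_le_of_norm_le (((hvf.2.add (hg.2.const_mul 2)).add hgi).const_mul δ)
    (Eventually.of_forall fun z => ?_)
  obtain ⟨-, n2⟩ := norm_wdz_cplx_sq_le (hχ.differentiable one_ne_zero z) (hχ0 z) (hδ z) j
  obtain ⟨n1, -⟩ := norm_wdz_cplx_sq_le (hχ.differentiable one_ne_zero z) (hχ0 z) (hδ z) k
  have hδ0 : 0 ≤ δ := (norm_nonneg _).trans (hδ z)
  have hw := (wWt_pos (φ := φ) z).le
  have hcw : ‖cplx (wWt φ) z‖ = wWt φ z := by
    rw [cplx, norm_real, Real.norm_of_nonneg hw]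
  refine (norm_add_le _ _).trans ?_
  rw [norm_mul, norm_mul (_ * _) (wdzbar j _ z), norm_mul (_ * _) (cplx (wWt φ) z),
    norm_mul (_ * _) (cplx (wWt φ) z), norm_mul _ ((starRingEnd ℂ) (g z)),
    norm_mul _ ((starRingEnd ℂ) (g z)), RCLike.norm_conj, hcw]
  set a := ‖wdzbar j (cplx φ) z * f z‖
  set b := ‖g z‖
  set p := ‖pdz k f z‖
  have ha : 0 ≤ a := norm_nonneg _
  have hb0 : 0 ≤ b := norm_nonneg _
  have hp0 : 0 ≤ p := norm_nonneg _
  calc _ ≤ a * b * wWt φ z * (2 * δ * χ z) + p * b * wWt φ z * (2 * δ * χ z) := by gcongr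
    _ = δ * wWt φ z * (2 * (χ z * (a * b)) + 2 * ((χ z * p) * b)) := by ring
    _ ≤ δ * wWt φ z * ((a ^ 2 + b ^ 2) + ((χ z * p) ^ 2 + b ^ 2)) := by
      have e1 : χ z * (a * b) ≤ a * b := mul_le_of_le_one_left (by positivity) (hχ1 z)
      have e2 := two_mul_le_add_sq a b
      have e3 := two_mul_le_add_sq (χ z * p) b
      refine mul_le_mul_of_nonneg_left ?_ (by positivity)
      linarith
    _ = _ := by ring

end Weighted

/-- Kohn–Morrey type formula for the weighted `∂`-complex: for a `(1,0)`-form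
`u = Σ u_j dz_j` with coefficients in `A²(ℂⁿ, e^{-φ})` in `dom ∂ ∩ dom ∂*_φ`,
`‖∂u‖²_φ + ‖∂*_φ u‖²_φ = Σ_{j,k} ‖∂u_j/∂z_k‖²_φ + ∫ Σ_{j,k} φ_{k j̄} u_j ū_k e^{-φ}
 − Σ_{j,k} ((I−P_φ)(φ_{j̄} u_j), φ_{k̄} u_k)_φ`. -/
theorem stmt6 {n : ℕ} (φ : Cn n → ℝ) (hφ : ContDiff ℝ (⊤ : ℕ∞) φ) (hps : PSH φ)
    (u : Fin n → Cn n → ℂ) (hu : ∀ j, MemA φ (u j))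
    (hdom : ∀ j k, MemA φ (fun z => pdz k (u j) z - pdz j (u k) z))
    (v : Fin n → Cn n → ℂ) (hv : ∀ j, v j = fun z => wdzbar j (cplx φ) z * u j z)
    (hvL2 : ∀ j, MemL2 φ (v j))
    (Pv : Fin n → Cn n → ℂ) (hPv : ∀ j, IsBergProj φ (v j) (Pv j)) :
    (∑ j, ∑ k ∈ Finset.Ioi j, wNormSq φ (fun z => pdz k (u j) z - pdz j (u k) z))
        + wNormSq φ (fun z => ∑ j, Pv j z)
      = (∑ j, ∑ k, wNormSq φ (pdz k (u j)))
        + (∫ z : Cn n, (∑ j, ∑ k, levi φ j k z * u j z * (starRingEnd ℂ) (u k z)).re * wWt φ z)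
        - (∑ j, ∑ k, wInner φ (fun z => v j z - Pv j z) (v k)).re := by
  have hφ1 : ContDiff ℝ 1 φ := hφ.of_le (mod_cast le_top)
  have hφ2 : ContDiff ℝ (0 + 1 + 1) φ := by
    simpa [one_add_one_eq_two] using contDiff_infty.1 hφ 2
  have hφc : Continuous φ := hφ.continuous
  have hwc : Continuous (wWt φ) := hφ1.wWt.continuous
  have huc : ∀ j, Continuous (u j) := fun j => (hu j).1.continuous
  have hpc : ∀ j k, Continuous (pdz k (u j)) := fun j k =>
    ((hu j).1.differentiable_fderiv_apply _).continuous
  have hlc : ∀ j k, Continuous (levi φ j k) := fun j k => ((hφ2.cplx.wdzbar j).wdz k).continuous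
  have hbc : ∀ j, Continuous (wdzbar j (cplx φ)) := fun j => (hφ2.cplx.wdzbar j).continuous
  have hvc : ∀ j, Continuous (v j) := fun j => by
    rw [hv j]
    exact (hbc j).mul (huc j)
  set A : Cn n → ℝ := fun z =>
    (∑ j, ∑ k, levi φ j k z * u j z * (starRingEnd ℂ) (u k z)).re * wWt φ z with hA
  set G : Cn n → ℝ := fun z => ∑ j, ∑ k, ‖pdz k (u j) z‖ ^ 2 * wWt φ z with hG
  set D : Cn n → ℝ := fun z =>
    ∑ j, ∑ k ∈ Finset.Ioi j, ‖pdz k (u j) z - pdz j (u k) z‖ ^ 2 * wWt φ z with hD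
  set N : Cn n → ℝ := fun z => ‖∑ j, v j z‖ ^ 2 * wWt φ z with hN
  set T : Fin n → Fin n → Cn n → ℂ := fun j k z =>
    (levi φ j k z * u j z * (starRingEnd ℂ) (u k z) - v j z * (starRingEnd ℂ) (v k z)
      + pdz k (u j) z * (starRingEnd ℂ) (pdz j (u k) z)) * wWt φ z with hT
  have hAc : Continuous A :=
    (continuous_re.comp (continuous_finsetSum _ fun j _ => continuous_finsetSum _ fun k _ =>
      ((hlc j k).mul (huc j)).mul (continuous_conj.comp (huc k)))).mul hwc
  have hGc : Continuous G := continuous_finsetSum _ fun j _ => continuous_finsetSum _ fun k _ =>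
    ((hpc j k).norm.pow 2).mul hwc
  have hTc : ∀ j k, Continuous (T j k) := fun j k =>
    (((((hlc j k).mul (huc j)).mul (continuous_conj.comp (huc k))).sub
      ((hvc j).mul (continuous_conj.comp (hvc k)))).add
      ((hpc j k).mul (continuous_conj.comp (hpc k j)))).mul (continuous_ofReal.comp hwc)
  have hA0 : ∀ z, 0 ≤ A z := fun z => mul_nonneg (hps z fun j => u j z) (wWt_pos z).le
  have hG0 : ∀ z, 0 ≤ G z := fun z => Finset.sum_nonneg fun j _ => Finset.sum_nonneg fun k _ =>
    mul_nonneg (sq_nonneg _) (wWt_pos z).le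
  have hDi : Integrable D := integrable_finsetSum _ fun j _ => integrable_finsetSum _ fun k _ =>
    (hdom j k).2
  have hNi : Integrable N := MemL2.integrable_norm_sq_sum hφc hvL2
  have hpt : ∀ z, ∑ j, ∑ k, (T j k z).re = (A z + G z) - (N z + D z) := fun z => by
    have hanti := sum_Ioi_norm_sub_sq fun j k => pdz k (u j) z
    have hnorm := norm_sq_sum_eq fun j => v j z
    simp only [hT, hA, hG, hN, hD, re_mul_ofReal, ← Finset.sum_mul, hanti, hnorm, add_re, sub_re,
      Finset.sum_add_distrib, Finset.sum_sub_distrib, re_sum]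
    ring
  obtain ⟨χ, δ, hδ, hχ, hχc, hχ0, hχ1, hχt, hχδ⟩ := exists_cutoff n
  have hηc : ∀ m, HasCompactSupport fun z => χ m z ^ 2 := fun m =>
    (hχc m).comp_left (g := fun t : ℝ => t ^ 2) (by simp)
  have hη : ∀ m, Continuous fun z => χ m z ^ 2 := fun m => (hχ m).continuous.pow 2
  have hMi : ∀ j k, Integrable fun z => ‖v j z‖ ^ 2 * wWt φ z + 2 * (‖u k z‖ ^ 2 * wWt φ z) :=
    fun j k => (hvL2 j).2.add ((hu k).2.const_mul 2)
  have hcut : ∀ m, |∫ z, χ m z ^ 2 * ((A z + G z) - (N z + D z))| ≤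
      δ m * ((∫ z, ∑ j, ∑ k, (‖v j z‖ ^ 2 * wWt φ z + 2 * (‖u k z‖ ^ 2 * wWt φ z)))
        + ∫ z, χ m z ^ 2 * (A z + G z)) := by
    intro m
    have hδ0 : 0 ≤ δ m := (norm_nonneg _).trans (hχδ m 0)
    have hTi : ∀ j k, Integrable fun z => T j k z * (χ m z ^ 2 : ℝ) := fun j k =>
      ((hTc j k).mul (continuous_ofReal.comp (hη m))).integrable_of_hasCompactSupport
        ((hηc m).comp_left (g := fun t : ℝ => (t : ℂ)) (by simp)).mul_left
    have hgi : ∀ j k, Integrable fun z => χ m z ^ 2 * (‖pdz k (u j) z‖ ^ 2 * wWt φ z) :=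
      fun j k => ((hη m).mul (((hpc j k).norm.pow 2).mul hwc)).integrable_of_hasCompactSupport
        (hηc m).mul_right
    have hGi : Integrable fun z => χ m z ^ 2 * G z :=
      ((hη m).mul hGc).integrable_of_hasCompactSupport (hηc m).mul_right
    have hAGi : Integrable fun z => χ m z ^ 2 * (A z + G z) :=
      ((hη m).mul (hAc.add hGc)).integrable_of_hasCompactSupport (hηc m).mul_right
    have hre : ∫ z, χ m z ^ 2 * ((A z + G z) - (N z + D z))
        = (∑ j, ∑ k, ∫ z, T j k z * (χ m z ^ 2 : ℝ)).re := by
      rw [re_sum_integral hTi]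
      simp only [re_mul_ofReal, ← Finset.sum_mul, hpt]
      simp only [mul_comm]
    have hle : ∀ j k, ‖∫ z, T j k z * (χ m z ^ 2 : ℝ)‖ ≤
        ∫ z, δ m * (‖v j z‖ ^ 2 * wWt φ z + 2 * (‖u k z‖ ^ 2 * wWt φ z)
          + χ m z ^ 2 * (‖pdz k (u j) z‖ ^ 2 * wWt φ z)) := fun j k => by
      have h := norm_integral_cutoff_le hφ (hu j) (hu k) j k (hv j ▸ hvL2 j) (hχ m) (hχc m)
        (hχ0 m) (hχ1 m) (hχδ m)
      simpa only [hT, hv] using h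
    rw [hre]
    calc _ ≤ ‖∑ j, ∑ k, ∫ z, T j k z * (χ m z ^ 2 : ℝ)‖ := abs_re_le_norm _
      _ ≤ ∑ j, ∑ k, ∫ z, δ m * (‖v j z‖ ^ 2 * wWt φ z + 2 * (‖u k z‖ ^ 2 * wWt φ z)
          + χ m z ^ 2 * (‖pdz k (u j) z‖ ^ 2 * wWt φ z)) :=
        norm_sum_le_of_le _ fun j _ => norm_sum_le_of_le _ fun k _ => hle j k
      _ = δ m * ((∫ z, ∑ j, ∑ k, (‖v j z‖ ^ 2 * wWt φ z + 2 * (‖u k z‖ ^ 2 * wWt φ z)))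
          + ∫ z, χ m z ^ 2 * G z) := by
        rw [← integral_add (integrable_sum_sum hMi) hGi, ← integral_const_mul,
          ← integral_sum_sum fun j k => ((hMi j k).fun_add (hgi j k)).const_mul (δ m)]
        simp only [hG, Finset.mul_sum, mul_add, Finset.sum_add_distrib]
      _ ≤ _ := by
        refine mul_le_mul_of_nonneg_left (add_le_add_right ?_ _) hδ0
        exact integral_mono hGi hAGi fun z =>
          mul_le_mul_of_nonneg_left (le_add_of_nonneg_left (hA0 z)) (sq_nonneg _)
  obtain ⟨hAGi, hAG⟩ := integral_eq_of_cutoff (hAc.add hGc)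
    (fun z => add_nonneg (hA0 z) (hG0 z)) (hNi.add hDi) hη hηc (fun m z => sq_nonneg _)
    (fun m z => pow_le_one₀ (hχ0 m z) (hχ1 m z)) (fun z => by simpa using (hχt z).pow 2) hδ hcut
  have hAi : Integrable A := hAGi.mono' hAc.aestronglyMeasurable (Eventually.of_forall fun z => by
    rw [Real.norm_of_nonneg (hA0 z)]
    exact le_add_of_nonneg_right (hG0 z))
  have hGi : Integrable G := hAGi.mono' hGc.aestronglyMeasurable (Eventually.of_forall fun z => by
    rw [Real.norm_of_nonneg (hG0 z)]
    exact le_add_of_nonneg_left (hA0 z))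
  have hGjk : ∀ j k, Integrable fun z => ‖pdz k (u j) z‖ ^ 2 * wWt φ z := fun j k =>
    hGi.mono' (((hpc j k).norm.pow 2).mul hwc).aestronglyMeasurable
      (Eventually.of_forall fun z => by
        have h0 : ∀ a b, 0 ≤ ‖pdz b (u a) z‖ ^ 2 * wWt φ z := fun a b =>
          mul_nonneg (sq_nonneg _) (wWt_pos z).le
        rw [Real.norm_of_nonneg (h0 j k)]
        exact (Finset.single_le_sum (f := fun b => ‖pdz b (u j) z‖ ^ 2 * wWt φ z)
          (fun b _ => h0 j b) (Finset.mem_univ k)).trans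
          (Finset.single_le_sum (f := fun a => ∑ b, ‖pdz b (u a) z‖ ^ 2 * wWt φ z)
            (fun a _ => Finset.sum_nonneg fun b _ => h0 a b) (Finset.mem_univ j)))
  have hGint : ∑ j, ∑ k, wNormSq φ (pdz k (u j)) = ∫ z, G z := (integral_sum_sum hGjk).symm
  have hDint : ∑ j, ∑ k ∈ Finset.Ioi j, wNormSq φ (fun z => pdz k (u j) z - pdz j (u k) z)
      = ∫ z, D z := by
    rw [integral_finsetSum _ fun j _ => integrable_finsetSum _ fun k _ => (hdom j k).2]
    exact Finset.sum_congr rfl fun j _ => (integral_finsetSum _ fun k _ => (hdom j k).2).symm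
  rw [integral_add' hAi hGi, integral_add' hNi hDi] at hAG
  rw [wNormSq_sum_bergProj hφc hvL2 hPv, hGint, hDint]
  linarith
end
end
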